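/- Let a, b, c, d, e ∈ ℂ with Re b > 0, Re c > 0 and Re(d+e-b-c) > 0, and assume that none of d, e, d+e-b-c is a nonpositive integer. Then for every real z with |z| < 1, ∫_0^1 t^{b-1} (1-t)^{d+e-b-c-1} F(d-c, e-c; d+e-b-c; 1-t) (1-tz)^{-a} dt = (Γ(b)Γ(c)Γ(d+e-b-c)/(Γ(d)Γ(e))) · ∑_{k≥0} ((a)_k (b)_k (c)_k)/((d)_k (e)_k k!) z^k (Karp–Sitnik formula expressing a ₃F₂ as a generalized Stieltjes-type integral of a ₂F₁). -/

import Mathlib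

open MeasureTheory Set Complex Filter

/-- Pochhammer symbol `(a)_k = a (a+1) ⋯ (a+k-1)`. -/
noncomputable def poch (a : ℂ) (k : ℕ) : ℂ := ∏ i ∈ Finset.range k, (a + i)

/-- The Gauss hypergeometric function `F(a,b;c;x)` for real `x < 1`, defined by the
power series on `[0,1)` and by the (agreeing) Pfaff series for `x < 0`. -/
noncomputable def hypF (a b c : ℂ) (x : ℝ) : ℂ :=
  if 0 ≤ x then
    ∑' k : ℕ, poch a k * poch b k / (poch c k * (Nat.factorial k : ℂ)) * (x : ℂ) ^ k
  else
    ((1 - x : ℝ) : ℂ) ^ (-a) *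
      ∑' k : ℕ, poch a k * poch (c - b) k / (poch c k * (Nat.factorial k : ℂ)) *
        (((x / (x - 1) : ℝ)) : ℂ) ^ k

open Topology Asymptotics

lemma poch_succ (a : ℂ) (k : ℕ) : poch a (k+1) = poch a k * (a + k) := by
  simp [poch, Finset.prod_range_succ]

lemma poch_succ_left (a : ℂ) (k : ℕ) : poch a (k+1) = a * poch (a+1) k := by
  simp only [poch, Finset.prod_range_succ', Nat.cast_zero, add_zero, Nat.cast_add, Nat.cast_one]
  rw [mul_comm]
  congr 1
  exact Finset.prod_congr rfl fun i _ => by ring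

lemma poch_ne_zero {a : ℂ} (h : ∀ n : ℕ, a ≠ -(n : ℂ)) (k : ℕ) : poch a k ≠ 0 := by
  rw [poch, Finset.prod_ne_zero_iff]
  intro i _ h0
  exact h i (eq_neg_of_add_eq_zero_left h0)

lemma ne_neg_nat {a : ℂ} (h : 0 < a.re) (n : ℕ) : a ≠ -(n : ℂ) := by
  rintro rfl
  simp at h
  linarith [Nat.cast_nonneg (α := ℝ) n]

lemma Gamma_add_nat {a : ℂ} (h : ∀ n : ℕ, a ≠ -(n : ℂ)) (k : ℕ) :
    Complex.Gamma (a + k) = poch a k * Complex.Gamma a := by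
  induction k with
  | zero => simp [poch]
  | succ k ih =>
    rw [poch_succ, Nat.cast_succ, ← add_assoc, Complex.Gamma_add_one, ih]
    · ring
    · intro h0
      exact h k (eq_neg_of_add_eq_zero_left h0)

/-- Normalised Pochhammer symbol tends to `1/Γ`. -/
lemma poch_tendsto (x : ℂ) :
    Tendsto (fun n : ℕ => poch x n / ((n : ℂ) ^ (x - 1) * (Nat.factorial n : ℂ))) atTop
      (𝓝 (Complex.Gamma x)⁻¹) := by
  by_cases h : ∀ n : ℕ, x ≠ -(n : ℂ)
  · have h1 := (Complex.GammaSeq_tendsto_Gamma x).inv₀ (Complex.Gamma_ne_zero h)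
    have h2 : Tendsto (fun n : ℕ => (n : ℂ) / (n + x)) atTop (𝓝 1) :=
      tendsto_natCast_div_add_atTop x
    have h3 := h2.mul h1
    rw [one_mul] at h3
    refine h3.congr' ?_
    filter_upwards [eventually_gt_atTop 0] with n hn
    have hn0 : (n : ℂ) ≠ 0 := by exact_mod_cast hn.ne'
    have hx : (n : ℂ) + x ≠ 0 := by
      intro h0
      exact h n (eq_neg_of_add_eq_zero_right h0)
    have hp : (n : ℂ) ^ x ≠ 0 := by simp [Complex.cpow_eq_zero_iff, hn0]
    have hf : (Nat.factorial n : ℂ) ≠ 0 := by exact_mod_cast Nat.factorial_ne_zero n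
    rw [Complex.GammaSeq, Complex.cpow_sub _ _ hn0, Complex.cpow_one]
    change _ * ((n : ℂ) ^ x * _ / poch x (n+1))⁻¹ = _
    rw [poch_succ]
    have hx' : x + (n : ℂ) ≠ 0 := by rwa [add_comm]
    have hpo := poch_ne_zero h n
    field_simp
    ring
  · push Not at h
    obtain ⟨m, rfl⟩ := h
    rw [Complex.Gamma_neg_nat_eq_zero, inv_zero]
    refine tendsto_const_nhds.congr' ?_
    filter_upwards [eventually_gt_atTop m] with n hn
    have : poch (-(m:ℂ)) n = 0 := by
      rw [poch, Finset.prod_eq_zero_iff]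
      exact ⟨m, Finset.mem_range.2 hn, by simp⟩
    simp [this]

lemma norm_aux (x : ℂ) : ∀ᶠ n : ℕ in atTop, ‖(n : ℂ) ^ (x - 1) * (Nat.factorial n : ℂ)‖
     = (n:ℝ) ^ (x.re - 1) * (Nat.factorial n : ℝ) := by
  filter_upwards [eventually_gt_atTop 0] with n hn
  rw [norm_mul, Complex.norm_natCast_cpow_of_pos hn]
  simp

lemma poch_isBigO (x : ℂ) :
    (fun n : ℕ => poch x n) =O[atTop] (fun n : ℕ => (n:ℝ) ^ (x.re - 1) * (Nat.factorial n : ℝ)) := by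
  have h := isBigO_of_div_tendsto_nhds (f := fun n : ℕ => poch x n)
    (g := fun n : ℕ => (n : ℂ) ^ (x - 1) * (Nat.factorial n : ℂ)) (l := atTop) ?_ _ (poch_tendsto x)
  · refine h.norm_right.congr' EventuallyEq.rfl (norm_aux x)
  · filter_upwards [eventually_gt_atTop 0] with n hn h0
    have hn0 : (n : ℂ) ≠ 0 := by exact_mod_cast hn.ne'
    have hf : (Nat.factorial n : ℂ) ≠ 0 := by exact_mod_cast Nat.factorial_ne_zero n
    simp [Complex.cpow_eq_zero_iff, hn0, hf] at h0

lemma poch_inv_isBigO {x : ℂ} (hx : ∀ n : ℕ, x ≠ -(n : ℂ)) :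
    (fun n : ℕ => (poch x n)⁻¹) =O[atTop]
      (fun n : ℕ => ((n:ℝ) ^ (x.re - 1) * (Nat.factorial n : ℝ))⁻¹) := by
  have h := isBigO_of_div_tendsto_nhds_of_ne_zero
    (poch_tendsto x) (inv_ne_zero (Complex.Gamma_ne_zero hx))
  have h' := h.inv_rev (by
    filter_upwards [eventually_gt_atTop 0] with n hn h0
    have hn0 : (n : ℂ) ≠ 0 := by exact_mod_cast hn.ne'
    have hf : (Nat.factorial n : ℂ) ≠ 0 := by exact_mod_cast Nat.factorial_ne_zero n
    simp [Complex.cpow_eq_zero_iff, hn0, hf] at h0)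
  refine h'.norm_right.congr' EventuallyEq.rfl ?_
  filter_upwards [norm_aux x] with n hn
  rw [norm_inv, hn]
/-- Coefficients of the Gauss series. -/
noncomputable def hcoef (A B C : ℂ) (n : ℕ) : ℂ :=
  poch A n * poch B n / (poch C n * (Nat.factorial n : ℂ))

lemma hcoef_isBigO (A B : ℂ) {C : ℂ} (hC : ∀ n : ℕ, C ≠ -(n : ℂ)) :
    hcoef A B C =O[atTop] (fun n : ℕ => (n:ℝ) ^ ((A + B - C).re - 1)) := by
  have hfac : (fun n : ℕ => ((Nat.factorial n : ℂ))⁻¹) =O[atTop]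
      (fun n : ℕ => ((Nat.factorial n : ℝ))⁻¹) :=
    IsBigO.of_bound 1 (Eventually.of_forall fun n => by simp)
  have h := ((poch_isBigO A).mul (poch_isBigO B)).mul ((poch_inv_isBigO hC).mul hfac)
  refine (h.congr' ?_ ?_)
  · refine Eventually.of_forall fun n => ?_
    simp [hcoef, div_eq_mul_inv, mul_comm]
  · filter_upwards [eventually_gt_atTop 0] with n hn
    have hn0 : (0 : ℝ) < n := by exact_mod_cast hn
    have hf : (Nat.factorial n : ℝ) ≠ 0 := by exact_mod_cast Nat.factorial_ne_zero n
    have e : (A + B - C).re - 1 = (A.re - 1) + (B.re - 1) - (C.re - 1) := by simp; ring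
    rw [e, Real.rpow_sub hn0 (_ + _), Real.rpow_add hn0]
    have := (Real.rpow_pos_of_pos hn0 (C.re - 1)).ne'
    field_simp

lemma hcoef_summable {A B C : ℂ} (hC : ∀ n : ℕ, C ≠ -(n : ℂ)) (h : 0 < (C - A - B).re) :
    Summable (hcoef A B C) := by
  refine summable_of_isBigO_nat (Real.summable_nat_rpow.2 ?_) (hcoef_isBigO A B hC)
  simp at h ⊢
  linarith

lemma hcoef_summable_pow (A B : ℂ) {C : ℂ} (hC : ∀ n : ℕ, C ≠ -(n : ℂ)) {x : ℂ} (hx : ‖x‖ < 1) :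
    Summable (fun n => hcoef A B C n * x ^ n) := by
  obtain ⟨N, hN⟩ := exists_nat_gt ((A + B - C).re - 1)
  have h1 : (fun n : ℕ => (n:ℝ) ^ ((A + B - C).re - 1)) =O[atTop] (fun n : ℕ => (n:ℝ) ^ N) := by
    refine IsBigO.of_bound 1 ?_
    filter_upwards [eventually_gt_atTop 0] with n hn
    have hn1 : (1 : ℝ) ≤ n := by exact_mod_cast hn
    rw [Real.norm_of_nonneg (by positivity), Real.norm_of_nonneg (by positivity), one_mul,
      ← Real.rpow_natCast]
    exact Real.rpow_le_rpow_of_exponent_le hn1 hN.le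
  have h3 := summable_pow_mul_geometric_of_norm_lt_one (R := ℝ) N (r := ‖x‖) (by simpa using hx)
  refine summable_of_isBigO_nat h3 (IsBigO.trans (IsBigO.of_bound 1 ?_)
    (((hcoef_isBigO A B hC).trans h1).norm_left.mul (isBigO_refl (fun n : ℕ => ‖x‖ ^ n) atTop)))
  refine Eventually.of_forall fun n => ?_
  simp

lemma hcoef_succ (A B : ℂ) {C : ℂ} (hC : ∀ n : ℕ, C ≠ -(n : ℂ)) (n : ℕ) :
    ((n : ℂ) + 1) * hcoef A B C (n+1) = hcoef A B C n * ((A + n) * (B + n) / (C + n)) := by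
  have h1 := poch_ne_zero hC n
  have h2 : C + n ≠ 0 := fun h0 => hC n (eq_neg_of_add_eq_zero_left h0)
  have hf : (Nat.factorial n : ℂ) ≠ 0 := by exact_mod_cast Nat.factorial_ne_zero n
  have hn : (n : ℂ) + 1 ≠ 0 := by exact_mod_cast n.succ_ne_zero
  simp only [hcoef, poch_succ, Nat.factorial_succ, Nat.cast_mul, Nat.cast_add, Nat.cast_one]
  field_simp

lemma hcoef_C_succ (A B : ℂ) {C : ℂ} (hC : ∀ n : ℕ, C ≠ -(n : ℂ)) (n : ℕ) :
    hcoef A B (C+1) n = hcoef A B C n * (C / (C + n)) := by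
  have hC0 : C ≠ 0 := by simpa using hC 0
  have h1 := poch_ne_zero hC n
  have h2 : C + n ≠ 0 := fun h0 => hC n (eq_neg_of_add_eq_zero_left h0)
  have h3 : C * poch (C+1) n = poch C n * (C + n) := by rw [← poch_succ_left, poch_succ]
  have h4 : poch (C+1) n = poch C n * (C + n) / C := by rw [← h3]; field_simp
  simp only [hcoef, h4]
  field_simp

lemma gauss_step {A B C : ℂ} (hC : ∀ n : ℕ, C ≠ -(n : ℂ)) (h : 0 < (C - A - B).re) :
    (C - A - B) * C * ∑' n, hcoef A B C n = (C - A) * (C - B) * ∑' n, hcoef A B (C+1) n := by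
  have hC1 : ∀ n : ℕ, C + 1 ≠ -(n : ℂ) := fun n h0 => hC (n+1) (by
    push_cast; linear_combination h0)
  have hs := hcoef_summable hC h
  have hs1 : Summable (hcoef A B (C+1)) := hcoef_summable hC1 (by
    simp at h ⊢; linarith)
  have hg : Tendsto (fun n : ℕ => (n : ℂ) * hcoef A B C n) atTop (𝓝 0) := by
    have h1 := (isBigO_refl (fun n : ℕ => (n : ℝ)) atTop).norm_left.mul (hcoef_isBigO A B hC).norm_left
    have h2 : (fun n : ℕ => (n : ℂ) * hcoef A B C n) =O[atTop]
        (fun n : ℕ => (n : ℝ) ^ (-(C - A - B).re)) := by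
      rw [← isBigO_norm_left]
      refine h1.congr' ?_ ?_
      · exact Eventually.of_forall fun n => by simp
      · filter_upwards [eventually_gt_atTop 0] with n hn
        have hn0 : (0 : ℝ) < n := by exact_mod_cast hn
        have e : -(C - A - B).re = 1 + ((A + B - C).re - 1) := by simp; ring
        rw [e, Real.rpow_add hn0, Real.rpow_one]
    exact h2.trans_tendsto ((tendsto_rpow_neg_atTop h).comp tendsto_natCast_atTop_atTop)
  have key : ∀ n : ℕ, (C - A - B) * C * hcoef A B C n - (C - A) * (C - B) * hcoef A B (C+1) n
      = C * ((n : ℂ) * hcoef A B C n) - C * (((n + 1 : ℕ) : ℂ) * hcoef A B C (n+1)) := by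
    intro n
    have h2 : C + n ≠ 0 := fun h0 => hC n (eq_neg_of_add_eq_zero_left h0)
    rw [Nat.cast_succ, hcoef_succ A B hC, hcoef_C_succ A B hC]
    field_simp
    ring
  have t1 : HasSum (fun n => (C - A - B) * C * hcoef A B C n - (C - A) * (C - B) * hcoef A B (C+1) n)
      ((C - A - B) * C * ∑' n, hcoef A B C n - (C - A) * (C - B) * ∑' n, hcoef A B (C+1) n) :=
    (hs.hasSum.mul_left _).sub (hs1.hasSum.mul_left _)
  have t2 := t1.tendsto_sum_nat
  simp_rw [key] at t2
  have t3 : ∀ m : ℕ, ∑ n ∈ Finset.range m, (C * ((n : ℂ) * hcoef A B C n) - C * (((n + 1 : ℕ) : ℂ) * hcoef A B C (n+1))) = - (C * ((m : ℂ) * hcoef A B C m)) := by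
    intro m
    rw [Finset.sum_range_sub' (fun n : ℕ => C * ((n : ℂ) * hcoef A B C n))]
    simp
  simp_rw [t3] at t2
  have t4 := (hg.const_mul C).neg
  simp only [mul_zero, neg_zero] at t4
  exact sub_eq_zero.1 (tendsto_nhds_unique t2 t4)

lemma gauss_iter {A B C : ℂ} (hC : 0 < C.re) (h : 0 < (C - A - B).re) (m : ℕ) :
    poch (C - A - B) m * poch C m * ∑' n, hcoef A B C n
      = poch (C - A) m * poch (C - B) m * ∑' n, hcoef A B (C+m) n := by
  induction m with
  | zero => simp [poch]
  | succ m ih =>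
    have hm : (0:ℝ) ≤ m := Nat.cast_nonneg m
    have h1 := gauss_step (A := A) (B := B) (C := C + m)
      (ne_neg_nat (by simp; linarith)) (by simp at h ⊢; linarith)
    simp only [poch_succ]
    rw [Nat.cast_succ, ← add_assoc]
    linear_combination (C - A - B + m) * (C + m) * ih + poch (C - A) m * poch (C - B) m * h1

lemma gauss_lim {A B C : ℂ} (hC : 0 < C.re) (h : 0 < (C - A - B).re) :
    Tendsto (fun m : ℕ => ∑' n, hcoef A B (C+m) n) atTop (𝓝 1) := by
  have hs := hcoef_summable (ne_neg_nat hC) h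
  have key := tendsto_tsum_of_dominated_convergence (𝓕 := atTop)
    (f := fun m : ℕ => hcoef A B (C+m))
    (g := fun n => poch A n * poch B n * ((∏ i ∈ Finset.range n, (0:ℂ)) * (Nat.factorial n : ℂ)⁻¹))
    hs.norm ?_ ?_
  · rw [tsum_eq_single 0] at key
    · simpa [poch] using key
    · intro n hn
      simp [hn]
  · intro n
    have h1 : ∀ m : ℕ, hcoef A B (C + m) n = poch A n * poch B n *
        ((∏ i ∈ Finset.range n, (C + m + i)⁻¹) * (Nat.factorial n : ℂ)⁻¹) := by
      intro m
      rw [hcoef, div_eq_mul_inv, mul_inv, poch, poch, poch, Finset.prod_inv_distrib]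
    simp_rw [h1]
    refine Tendsto.const_mul _ (Tendsto.mul_const _ (tendsto_finsetProd _ fun i _ => ?_))
    refine squeeze_zero_norm' ?_ (tendsto_inv_atTop_nhds_zero_nat (𝕜 := ℝ))
    filter_upwards [eventually_gt_atTop 0] with m hm
    have hm0 : (0 : ℝ) < m := by exact_mod_cast hm
    have hi : (0:ℝ) ≤ i := Nat.cast_nonneg i
    rw [norm_inv]
    refine inv_anti₀ hm0 (le_trans ?_ (Complex.re_le_norm _))
    simp
    linarith
  · refine Eventually.of_forall fun m n => ?_
    have hp : ‖poch C n‖ ≤ ‖poch (C+m) n‖ := by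
      rw [poch, poch, norm_prod, norm_prod]
      refine Finset.prod_le_prod (fun _ _ => norm_nonneg _) fun i _ => ?_
      rw [Complex.norm_def, Complex.norm_def]
      refine Real.sqrt_le_sqrt ?_
      have hm : (0:ℝ) ≤ m := Nat.cast_nonneg m
      have hi : (0:ℝ) ≤ i := Nat.cast_nonneg i
      simp only [Complex.normSq_apply, add_re, add_im, natCast_re, natCast_im]
      nlinarith
    have h0 : 0 < ‖poch C n‖ := norm_pos_iff.2 (poch_ne_zero (ne_neg_nat hC) n)
    have hf : 0 < (Nat.factorial n : ℝ) := by exact_mod_cast Nat.factorial_pos n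
    simp only [hcoef, norm_div, norm_mul, Complex.norm_natCast]
    gcongr

/-- Gauss' summation theorem. -/
lemma gauss {A B C : ℂ} (hC : 0 < C.re) (h : 0 < (C - A - B).re) :
    ∑' n, hcoef A B C n = Complex.Gamma C * Complex.Gamma (C - A - B) /
      (Complex.Gamma (C - A) * Complex.Gamma (C - B)) := by
  have hl := gauss_lim hC h
  have l1 := ((poch_tendsto (C - A)).mul (poch_tendsto (C - B))).mul hl
  have l2 := ((poch_tendsto (C - A - B)).mul (poch_tendsto C)).mul_const (∑' n, hcoef A B C n)
  have l3 := tendsto_nhds_unique (l2.congr' ?_) l1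
  · have g1 := Complex.Gamma_ne_zero_of_re_pos hC
    have g2 := Complex.Gamma_ne_zero_of_re_pos h
    rw [← mul_inv, ← mul_inv, mul_one] at l3
    rw [div_eq_mul_inv, ← l3]
    field_simp
  · filter_upwards [eventually_gt_atTop 0] with n hn
    have hn0 : (n : ℂ) ≠ 0 := by exact_mod_cast hn.ne'
    have hf : (Nat.factorial n : ℂ) ≠ 0 := by exact_mod_cast Nat.factorial_ne_zero n
    have e : (n : ℂ) ^ (C - A - B - 1) * (n : ℂ) ^ (C - 1) =
       (n : ℂ) ^ (C - A - 1) * (n : ℂ) ^ (C - B - 1) := by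
      rw [← Complex.cpow_add _ _ hn0, ← Complex.cpow_add _ _ hn0]
      congr 1
      ring
    have it := gauss_iter hC h n
    rw [div_mul_div_comm, div_mul_div_comm, div_mul_eq_mul_div, div_mul_eq_mul_div, it]
    congr 1
    linear_combination (Nat.factorial n : ℂ) ^ 2 * e
lemma beta_integrable {u v : ℂ} (hu : 0 < u.re) (hv : 0 < v.re) :
    IntegrableOn (fun t : ℝ => (t : ℂ) ^ (u - 1) * ((1 - t : ℝ) : ℂ) ^ (v - 1)) (Ioo 0 1) := by
  have h := Complex.betaIntegral_convergent hu hv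
  rw [intervalIntegrable_iff_integrableOn_Ioo_of_le zero_le_one] at h
  simpa using h

lemma beta_integral (u v : ℂ) :
    ∫ t in Ioo (0:ℝ) 1, (t : ℂ) ^ (u - 1) * ((1 - t : ℝ) : ℂ) ^ (v - 1) = Complex.betaIntegral u v := by
  rw [Complex.betaIntegral, intervalIntegral.integral_of_le zero_le_one, integral_Ioc_eq_integral_Ioo]
  simp

lemma beta_integral_norm (u v : ℂ) :
    ∫ t in Ioo (0:ℝ) 1, ‖(t : ℂ) ^ (u - 1) * ((1 - t : ℝ) : ℂ) ^ (v - 1)‖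
      = ‖Complex.betaIntegral (u.re : ℂ) (v.re : ℂ)‖ := by
  have h0 : ∀ x : ℝ, 0 < x → ∀ w : ℂ, ((‖(x : ℂ) ^ (w - 1)‖ : ℝ) : ℂ) = (x : ℂ) ^ ((w.re : ℂ) - 1) := by
    intro x hx w
    rw [Complex.norm_cpow_eq_rpow_re_of_pos hx, Complex.ofReal_cpow hx.le]
    simp
  have h : ((∫ t in Ioo (0:ℝ) 1, ‖(t : ℂ) ^ (u - 1) * ((1 - t : ℝ) : ℂ) ^ (v - 1)‖ : ℝ) : ℂ)
      = Complex.betaIntegral (u.re : ℂ) (v.re : ℂ) := by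
    rw [← beta_integral, ← integral_complex_ofReal]
    refine setIntegral_congr_fun measurableSet_Ioo fun t ht => ?_
    simp only [norm_mul, Complex.ofReal_mul]
    rw [h0 t ht.1, h0 (1 - t) (by linarith [ht.2])]
  rw [← h, Complex.norm_real, Real.norm_of_nonneg]
  exact integral_nonneg fun t => norm_nonneg _

lemma beta_poch {u v : ℂ} (hu : 0 < u.re) (hv : 0 < v.re) (n : ℕ) :
    Complex.betaIntegral u (v + n) = Complex.Gamma u * Complex.Gamma v / Complex.Gamma (u + v) *
      (poch v n / poch (u + v) n) := by
  have huv : 0 < (u + v).re := by simp; linarith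
  rw [Complex.betaIntegral_eq_Gamma_mul_div _ _ hu (by simp; positivity), ← add_assoc,
    Gamma_add_nat (ne_neg_nat hv), Gamma_add_nat (ne_neg_nat huv)]
  have := poch_ne_zero (ne_neg_nat huv) n
  have := Complex.Gamma_ne_zero_of_re_pos huv
  field_simp

section
variable {A B b s : ℂ}

/-- Terms of the series under the integral. -/
noncomputable def fterm (A B b s : ℂ) (n : ℕ) (t : ℝ) : ℂ :=
  hcoef A B s n * ((t : ℂ) ^ (b - 1) * ((1 - t : ℝ) : ℂ) ^ (s + n - 1))

lemma re_add_nat_pos (hs : 0 < s.re) (n : ℕ) : 0 < (s + n).re := by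
  simp; positivity

lemma fterm_integrable (A B : ℂ) (hb : 0 < b.re) (hs : 0 < s.re) (n : ℕ) :
    IntegrableOn (fterm A B b s n) (Ioo 0 1) :=
  (beta_integrable hb (re_add_nat_pos hs n)).const_mul _

lemma fterm_summable (hb : 0 < b.re) (hs : 0 < s.re) (h : 0 < (s + b - A - B).re) :
    Summable (fun n => ∫ t in Ioo (0:ℝ) 1, ‖fterm A B b s n t‖) := by
  have e : ∀ n, ∫ t in Ioo (0:ℝ) 1, ‖fterm A B b s n t‖ =
      ‖Complex.Gamma (b.re : ℂ) * Complex.Gamma (s.re : ℂ) / Complex.Gamma ((b.re : ℂ) + (s.re : ℂ))‖ *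
      ‖hcoef A B s n * (poch (s.re : ℂ) n * (poch ((b.re : ℂ) + (s.re : ℂ)) n)⁻¹)‖ := by
    intro n
    simp only [fterm]
    simp_rw [norm_mul (hcoef A B s n)]
    rw [integral_const_mul, beta_integral_norm]
    have : (((s + n).re : ℝ) : ℂ) = (s.re : ℂ) + n := by simp
    rw [this, beta_poch (by simpa using hb) (by simpa using hs), norm_mul, div_eq_mul_inv (poch _ _)]
    ring
  simp_rw [e]
  refine Summable.mul_left _ (Summable.norm ?_)
  have hbs : ∀ n : ℕ, (b.re : ℂ) + (s.re : ℂ) ≠ -(n : ℂ) := ne_neg_nat (by simp; linarith)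
  have o := (hcoef_isBigO A B (ne_neg_nat hs)).mul ((poch_isBigO (s.re : ℂ)).mul (poch_inv_isBigO hbs))
  have hsum : Summable (fun n : ℕ => (n : ℝ) ^ (-(s + b - A - B).re - 1)) :=
    Real.summable_nat_rpow.2 (by linarith)
  refine summable_of_isBigO_nat hsum (o.congr' EventuallyEq.rfl ?_)
  filter_upwards [eventually_gt_atTop 0] with n hn
  have hn0 : (0 : ℝ) < n := by exact_mod_cast hn
  have hf : (Nat.factorial n : ℝ) ≠ 0 := by exact_mod_cast Nat.factorial_ne_zero n
  have e : -(s + b - A - B).re - 1 = ((A + B - s).re - 1) + ((s.re : ℂ).re - 1) -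
    (((b.re : ℂ) + (s.re : ℂ)).re - 1) := by simp; ring
  rw [e, Real.rpow_sub hn0 (_ + _), Real.rpow_add hn0]
  have := (Real.rpow_pos_of_pos hn0 (((b.re : ℂ) + (s.re : ℂ)).re - 1)).ne'
  field_simp

lemma fterm_eq (A B b s : ℂ) (n : ℕ) {t : ℝ} (ht : t ∈ Ioo (0:ℝ) 1) :
    fterm A B b s n t = (t : ℂ) ^ (b - 1) * ((1 - t : ℝ) : ℂ) ^ (s - 1) *
      (hcoef A B s n * ((1 - t : ℝ) : ℂ) ^ n) := by
  have h0 : ((1 - t : ℝ) : ℂ) ≠ 0 := by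
    have : 1 - t ≠ 0 := by linarith [ht.2]
    exact_mod_cast this
  rw [fterm, show s + n - 1 = (s - 1) + n by ring, Complex.cpow_add _ _ h0, Complex.cpow_natCast]
  ring

lemma hypF_hasSum (A B b : ℂ) (hs : 0 < s.re) {t : ℝ} (ht : t ∈ Ioo (0:ℝ) 1) :
    HasSum (fun n => fterm A B b s n t)
      ((t : ℂ) ^ (b - 1) * ((1 - t : ℝ) : ℂ) ^ (s - 1) * hypF A B s (1 - t)) := by
  simp_rw [fterm_eq A B b s _ ht]
  rw [hypF, if_pos (by linarith [ht.2])]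
  refine HasSum.mul_left _ (Summable.hasSum ?_)
  refine hcoef_summable_pow A B (ne_neg_nat hs) ?_
  rw [Complex.norm_real, Real.norm_of_nonneg (by linarith [ht.2])]
  linarith [ht.1]

lemma G_integrable (hb : 0 < b.re) (hs : 0 < s.re) (h : 0 < (s + b - A - B).re) :
    IntegrableOn (fun t : ℝ => (t : ℂ) ^ (b - 1) * ((1 - t : ℝ) : ℂ) ^ (s - 1) *
      hypF A B s (1 - t)) (Ioo 0 1) := by
  have hae : ∀ᵐ t ∂(volume.restrict (Ioo (0:ℝ) 1)), HasSum (fun n => fterm A B b s n t)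
      ((t : ℂ) ^ (b - 1) * ((1 - t : ℝ) : ℂ) ^ (s - 1) * hypF A B s (1 - t)) :=
    (ae_restrict_mem measurableSet_Ioo).mono fun t ht => hypF_hasSum A B b hs ht
  have hi := fun n => fterm_integrable (b := b) (s := s) A B hb hs n
  refine ⟨aestronglyMeasurable_of_tendsto_ae atTop
    (f := fun N t => ∑ n ∈ Finset.range N, fterm A B b s n t) (fun N => ?_)
    (hae.mono fun t ht => ht.tendsto_sum_nat), ?_⟩
  · exact (integrable_finsetSum _ fun n _ => hi n).aestronglyMeasurable
  · have h1 : ∫⁻ t in Ioo (0:ℝ) 1, ‖(t : ℂ) ^ (b - 1) * ((1 - t : ℝ) : ℂ) ^ (s - 1) *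
        hypF A B s (1 - t)‖ₑ ≤ ∫⁻ t in Ioo (0:ℝ) 1, ∑' n, ‖fterm A B b s n t‖ₑ := by
      refine lintegral_mono_ae (hae.mono fun t ht => ?_)
      rw [← ht.tsum_eq]
      exact enorm_tsum_le_tsum_enorm
    refine lt_of_le_of_lt h1 ?_
    rw [lintegral_tsum fun n => (hi n).aestronglyMeasurable.enorm]
    have h2 : ∀ n, ∫⁻ t in Ioo (0:ℝ) 1, ‖fterm A B b s n t‖ₑ
        = ENNReal.ofReal (∫ t in Ioo (0:ℝ) 1, ‖fterm A B b s n t‖) := fun n =>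
      (ofReal_integral_norm_eq_lintegral_enorm (hi n)).symm
    simp_rw [h2]
    exact (fterm_summable hb hs h).tsum_ofReal_lt_top

lemma G_integral (hb : 0 < b.re) (hs : 0 < s.re) (h : 0 < (s + b - A - B).re) :
    ∫ t in Ioo (0:ℝ) 1, (t : ℂ) ^ (b - 1) * ((1 - t : ℝ) : ℂ) ^ (s - 1) * hypF A B s (1 - t)
      = Complex.Gamma b * Complex.Gamma s * Complex.Gamma (s + b - A - B) /
        (Complex.Gamma (s + b - A) * Complex.Gamma (s + b - B)) := by
  have hbs : 0 < (s + b).re := by simp; linarith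
  have h1 := integral_tsum_of_summable_integral_norm
    (fun n => fterm_integrable (b := b) (s := s) A B hb hs n) (fterm_summable hb hs h)
  have h2 : ∫ t in Ioo (0:ℝ) 1, (t : ℂ) ^ (b - 1) * ((1 - t : ℝ) : ℂ) ^ (s - 1) * hypF A B s (1 - t)
      = ∫ t in Ioo (0:ℝ) 1, ∑' n, fterm A B b s n t :=
    setIntegral_congr_fun measurableSet_Ioo fun t ht => (hypF_hasSum A B b hs ht).tsum_eq.symm
  rw [h2, ← h1]
  have h3 : ∀ n, ∫ t in Ioo (0:ℝ) 1, fterm A B b s n t =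
      Complex.Gamma b * Complex.Gamma s / Complex.Gamma (s + b) * hcoef A B (s + b) n := by
    intro n
    simp only [fterm]
    rw [integral_const_mul, beta_integral, beta_poch hb hs, hcoef, hcoef, add_comm b s]
    have := poch_ne_zero (ne_neg_nat hs) n
    have := poch_ne_zero (ne_neg_nat hbs) n
    field_simp
  simp_rw [h3]
  rw [tsum_mul_left, gauss hbs h]
  have := Complex.Gamma_ne_zero_of_re_pos hbs
  field_simp

end

lemma binom_hasSum (a : ℂ) {x : ℝ} (hx : |x| < 1) :
    HasSum (fun k : ℕ => poch a k / (Nat.factorial k : ℂ) * (x : ℂ) ^ k)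
      (((1 - x : ℝ) : ℂ) ^ (-a)) := by
  have h := (Complex.one_div_one_sub_cpow_hasFPowerSeriesOnBall_zero a).hasSum (y := (x : ℂ)) (by
    rw [← ENNReal.ofReal_one, Metric.eball_ofReal]; simpa using hx)
  have hp : ∀ k, (ascPochhammer ℂ k).eval a = poch a k := by
    intro k
    induction k with
    | zero => simp [poch]
    | succ k ih => rw [ascPochhammer_succ_eval, ih, poch_succ]
  have hc : ∀ k : ℕ, Ring.choose (a + k - 1) k = poch a k / (Nat.factorial k : ℂ) := by
    intro k
    have hf : (Nat.factorial k : ℂ) ≠ 0 := by exact_mod_cast Nat.factorial_ne_zero k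
    have := Ring.factorial_nsmul_multichoose_eq_ascPochhammer a k
    rw [Polynomial.ascPochhammer_smeval_eq_eval, hp, nsmul_eq_mul] at this
    rw [← this, Ring.choose]
    field_simp
    ring_nf
  simp only [zero_add] at h
  have e1 : ((1 - x : ℝ) : ℂ) ^ (-a) = 1 / (1 - (x : ℂ)) ^ a := by
    rw [Complex.cpow_neg, one_div]
    simp
  rw [e1]
  have e2 : (fun k : ℕ => poch a k / (Nat.factorial k : ℂ) * (x : ℂ) ^ k) =
      fun n => (FormalMultilinearSeries.ofScalars ℂ (fun n : ℕ => Ring.choose (a + n - 1) n) n)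
        fun _ => (x : ℂ) := by
    funext k
    rw [FormalMultilinearSeries.ofScalars_apply_eq, hc, smul_eq_mul]
  rw [e2]
  exact h

/-- Karp–Sitnik formula: a `₃F₂` as a generalized Stieltjes-type integral of a `₂F₁`. -/
theorem stmt_11 (a b c d e : ℂ) (hb : 0 < b.re) (hc : 0 < c.re)
    (hde : 0 < (d + e - b - c).re)
    (hd : ∀ n : ℕ, d ≠ -(n : ℂ)) (he : ∀ n : ℕ, e ≠ -(n : ℂ))
    (hdebc : ∀ n : ℕ, d + e - b - c ≠ -(n : ℂ))
    (z : ℝ) (hz : |z| < 1) :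
    ∫ t in Ioo (0:ℝ) 1,
        (t : ℂ) ^ (b - 1) * ((1 - t : ℝ) : ℂ) ^ (d + e - b - c - 1) *
          hypF (d - c) (e - c) (d + e - b - c) (1 - t) * ((1 - t * z : ℝ) : ℂ) ^ (-a)
      = Complex.Gamma b * Complex.Gamma c * Complex.Gamma (d + e - b - c) /
          (Complex.Gamma d * Complex.Gamma e) *
        ∑' k : ℕ, poch a k * poch b k * poch c k /
          (poch d k * poch e k * (Nat.factorial k : ℂ)) * (z : ℂ) ^ k := by
  set s := d + e - b - c with hs_def
  have hC0 : (s + b - (d - c) - (e - c)) = c := by rw [hs_def]; ring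
  have hint := G_integrable (A := d - c) (B := e - c) hb hde (by rw [hC0]; exact hc)
  have hx : ∀ t ∈ Ioo (0:ℝ) 1, |t * z| < 1 := by
    intro t ht
    rw [abs_mul, abs_of_pos ht.1]
    nlinarith [ht.1, ht.2, abs_nonneg z]
  have hsum : Summable (fun k : ℕ => ‖poch a k / (Nat.factorial k : ℂ) * (z : ℂ) ^ k‖) :=
    (binom_hasSum a hz).summable.norm
  have main := hasSum_integral_of_dominated_convergence (μ := volume.restrict (Ioo (0:ℝ) 1))
    (F := fun k t => (t : ℂ) ^ (b - 1) * ((1 - t : ℝ) : ℂ) ^ (s - 1) *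
      hypF (d - c) (e - c) s (1 - t) *
      (poch a k / (Nat.factorial k : ℂ) * ((t * z : ℝ) : ℂ) ^ k))
    (f := fun t => (t : ℂ) ^ (b - 1) * ((1 - t : ℝ) : ℂ) ^ (s - 1) *
      hypF (d - c) (e - c) s (1 - t) * ((1 - t * z : ℝ) : ℂ) ^ (-a))
    (fun k t => ‖(t : ℂ) ^ (b - 1) * ((1 - t : ℝ) : ℂ) ^ (s - 1) *
      hypF (d - c) (e - c) s (1 - t)‖ * ‖poch a k / (Nat.factorial k : ℂ) * (z : ℂ) ^ k‖)
    (fun k => hint.aestronglyMeasurable.mul (Continuous.aestronglyMeasurable (by fun_prop)))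
    ?_ ?_ ?_ ?_
  · rw [← main.tsum_eq, ← tsum_mul_left]
    refine tsum_congr fun k => ?_
    have hbk : 0 < (b + k).re := re_add_nat_pos hb k
    have hCk : (s + (b + k) - (d - c) - (e - c)) = c + k := by rw [hs_def]; ring
    have hCA : (s + (b + k) - (d - c)) = e + k := by rw [hs_def]; ring
    have hCB : (s + (b + k) - (e - c)) = d + k := by rw [hs_def]; ring
    have mom := G_integral (A := d - c) (B := e - c) hbk hde
      (by rw [hCk]; exact re_add_nat_pos hc k)
    rw [hCk, hCA, hCB, Gamma_add_nat (ne_neg_nat hb), Gamma_add_nat (ne_neg_nat hc),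
      Gamma_add_nat hd, Gamma_add_nat he] at mom
    have e1 : ∫ t in Ioo (0:ℝ) 1, (t : ℂ) ^ (b - 1) * ((1 - t : ℝ) : ℂ) ^ (s - 1) *
        hypF (d - c) (e - c) s (1 - t) *
        (poch a k / (Nat.factorial k : ℂ) * ((t * z : ℝ) : ℂ) ^ k)
        = ∫ t in Ioo (0:ℝ) 1, (poch a k / (Nat.factorial k : ℂ) * (z : ℂ) ^ k) *
          ((t : ℂ) ^ (b + k - 1) * ((1 - t : ℝ) : ℂ) ^ (s - 1) *
            hypF (d - c) (e - c) s (1 - t)) := by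
      refine setIntegral_congr_fun measurableSet_Ioo fun t ht => ?_
      have h0 : (t : ℂ) ≠ 0 := by exact_mod_cast ht.1.ne'
      rw [show b + k - 1 = (b - 1) + k by ring, Complex.cpow_add _ _ h0, Complex.cpow_natCast,
        Complex.ofReal_mul, mul_pow]
      ring
    rw [e1, integral_const_mul, mom]
    have g1 := Complex.Gamma_ne_zero hd
    have g2 := Complex.Gamma_ne_zero he
    have g3 := poch_ne_zero hd k
    have g4 := poch_ne_zero he k
    have hf : (Nat.factorial k : ℂ) ≠ 0 := by exact_mod_cast Nat.factorial_ne_zero k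
    field_simp
  · intro k
    filter_upwards [ae_restrict_mem measurableSet_Ioo] with t ht
    rw [norm_mul]
    refine mul_le_mul_of_nonneg_left ?_ (norm_nonneg _)
    rw [norm_mul, norm_mul]
    refine mul_le_mul_of_nonneg_left ?_ (norm_nonneg _)
    rw [norm_pow, norm_pow, Complex.norm_real, Complex.norm_real]
    refine pow_le_pow_left₀ (norm_nonneg _) ?_ _
    rw [norm_mul, Real.norm_of_nonneg ht.1.le]
    nlinarith [norm_nonneg z, ht.1, ht.2]
  · exact Eventually.of_forall fun t => hsum.mul_left _
  · simp_rw [tsum_mul_left]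
    exact hint.norm.mul_const _
  · filter_upwards [ae_restrict_mem measurableSet_Ioo] with t ht
    exact (binom_hasSum a (hx t ht)).mul_left _
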